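/- Suppose α > 0 and n ≥ 1. Then the Jack_α probability that the largest part λ_1 is at least 2e·√(n/α) is at most α·n²/4^{2e·√(n/α)}; that is, Σ_{λ partition of n with λ_1 ≥ 2e·√(n/α)} π_α(λ) ≤ α·n²/4^{2e·√(n/α)}. -/

import Mathlib

open Finset

namespace JackTest

def colLen {n : ℕ} (lam : n.Partition) (j : ℕ) : ℕ :=
  (lam.parts.filter (fun p => j < p)).card

def rowLen {n : ℕ} (lam : n.Partition) (i : ℕ) : ℕ :=
  ((Finset.range n).filter (fun j => i < colLen lam j)).card

def cells {n : ℕ} (lam : n.Partition) : Finset (ℕ × ℕ) :=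
  (Finset.range n ×ˢ Finset.range n).filter (fun s => s.2 < rowLen lam s.1)

def arm {n : ℕ} (lam : n.Partition) (s : ℕ × ℕ) : ℕ := rowLen lam s.1 - (s.2 + 1)

def leg {n : ℕ} (lam : n.Partition) (s : ℕ × ℕ) : ℕ := colLen lam s.2 - (s.1 + 1)

noncomputable def cLow (α : ℝ) {n : ℕ} (lam : n.Partition) : ℝ :=
  ∏ s ∈ cells lam, (α * arm lam s + leg lam s + 1)

noncomputable def cUp (α : ℝ) {n : ℕ} (lam : n.Partition) : ℝ :=
  ∏ s ∈ cells lam, (α * arm lam s + leg lam s + α)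

noncomputable def jackP (α : ℝ) {n : ℕ} (lam : n.Partition) : ℝ :=
  α ^ n * (n.factorial) / (cLow α lam * cUp α lam)

def nStat {n : ℕ} (lam : n.Partition) : ℕ := ∑ i ∈ Finset.range n, i * rowLen lam i

def nStatConj {n : ℕ} (lam : n.Partition) : ℕ := ∑ j ∈ Finset.range n, j * colLen lam j

noncomputable def W (α : ℝ) {n : ℕ} (lam : n.Partition) : ℝ :=
  (α * nStatConj lam - nStat lam) / Real.sqrt (α * n.choose 2)

noncomputable def Phi (x : ℝ) : ℝ :=
  (Real.sqrt (2 * Real.pi))⁻¹ * ∫ t in Set.Iic x, Real.exp (-t ^ 2 / 2)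

lemma coeff_prod_X_sub_C_mul_X_sq {ι : Type*} [DecidableEq ι] (s : Finset ι) (u : ι → ℝ) :
    let q := (∏ j ∈ s, (Polynomial.X - Polynomial.C (u j))) * Polynomial.X ^ 2
    q.coeff (#s + 2) = 1 ∧ q.coeff (#s + 1) = -∑ j ∈ s, u j ∧
      q.coeff #s = ((∑ j ∈ s, u j) ^ 2 - ∑ j ∈ s, u j ^ 2) / 2 ∧
      ∀ k, #s + 2 < k → q.coeff k = 0 := by
  induction s using Finset.induction_on with
  | empty =>
    refine ⟨?_, ?_, ?_, ?_⟩ <;> simp [Polynomial.coeff_X_pow]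
    intro k hk; omega
  | insert a s ha ih =>
    obtain ⟨h2, h1, h0, hk⟩ := ih
    intro q
    set r := (∏ j ∈ s, (Polynomial.X - Polynomial.C (u j))) * Polynomial.X ^ 2 with hr
    have hq : q = Polynomial.X * r - Polynomial.C (u a) * r := by
      simp only [q, hr, prod_insert ha]; ring
    have hc : ∀ k, q.coeff (k + 1) = r.coeff k - u a * r.coeff (k + 1) := by
      intro k
      rw [hq, Polynomial.coeff_sub, Polynomial.coeff_X_mul, Polynomial.coeff_C_mul]
    rw [card_insert_of_notMem ha]
    refine ⟨?_, ?_, ?_, ?_⟩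
    · rw [show #s + 1 + 2 = #s + 2 + 1 by ring, hc, h2, hk _ (by omega)]; ring
    · rw [hc, h1, h2, sum_insert ha]; ring
    · rw [hc, h0, h1, sum_insert ha, sum_insert ha]; ring
    · intro k hk'
      obtain ⟨k, rfl⟩ : ∃ j, k = j + 1 := ⟨k - 1, by omega⟩
      rw [hc, hk k (by omega), hk (k + 1) (by omega)]; ring

lemma prod_sub_eq_erase {ι : Type*} [DecidableEq ι] {s : Finset ι} {i : ι} (hi : i ∈ s)
    (u : ι → ℝ) (a : ℝ) :
    ∏ j ∈ s, (u i - u j + a) = a * ∏ j ∈ s.erase i, (u i - u j + a) := by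
  rw [← mul_prod_erase s _ hi, sub_self, zero_add]

/-- A Lagrange interpolation identity: the transition weights of the anisotropic growth
process sum to one. -/
lemma sum_transition_eq_one {ι : Type*} [DecidableEq ι] (s t : Finset ι) (u : ι → ℝ)
    (hu : Set.InjOn u s) (hst : #s = #t + 1) (a : ℝ) :
    ∑ i ∈ s, (∏ j ∈ t, (u i - u j + a)) / ∏ j ∈ s.erase i, (u i - u j) = 1 := by
  have hm : (∏ j ∈ t, (Polynomial.X - Polynomial.C (u j - a))).Monic :=
    Polynomial.monic_prod_of_monic _ _ fun _ _ => Polynomial.monic_X_sub_C _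
  have hd : (#s : WithBot ℕ) = (∏ j ∈ t, (Polynomial.X - Polynomial.C (u j - a))).degree + 1 := by
    rw [Polynomial.degree_prod]
    simp only [Polynomial.degree_X_sub_C, sum_const, hst]
    simp
  have h := Lagrange.leadingCoeff_eq_sum hu hd
  rw [hm.leadingCoeff] at h
  rw [h]
  refine sum_congr rfl fun i _ => ?_
  rw [Polynomial.eval_prod]
  congr 1
  refine prod_congr rfl fun j _ => ?_
  simp; ring

lemma sum_cotransition {ι : Type*} [DecidableEq ι] (s : Finset ι) (u : ι → ℝ)
    (hu : Set.InjOn u s) (c : ℝ) :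
    ∑ i ∈ s, (u i + c) * ∏ j ∈ s.erase i, ((u i - u j - 1) / (u i - u j)) =
      #s * c + ∑ i ∈ s, u i - #s * (#s - 1) / 2 := by
  rcases s.eq_empty_or_nonempty with rfl | hne
  · simp
  obtain ⟨p2, p1, p0, pk⟩ := coeff_prod_X_sub_C_mul_X_sq s (fun j => u j + 1)
  obtain ⟨q2, q1, q0, qk⟩ := coeff_prod_X_sub_C_mul_X_sq s u
  set p := ∏ j ∈ s, (Polynomial.X - Polynomial.C (u j + 1)) with hp
  set q := ∏ j ∈ s, (Polynomial.X - Polynomial.C (u j)) with hq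
  set P := (Polynomial.X + Polynomial.C c) * p -
    (Polynomial.X + Polynomial.C (c - #s)) * q with hP
  have hPX : P * Polynomial.X ^ 2 =
      Polynomial.X * (p * Polynomial.X ^ 2) + Polynomial.C c * (p * Polynomial.X ^ 2) -
      (Polynomial.X * (q * Polynomial.X ^ 2) + Polynomial.C (c - #s) * (q * Polynomial.X ^ 2)) := by
    rw [hP]; ring
  have hc : ∀ k, (P * Polynomial.X ^ 2).coeff (k + 1) =
      (p * Polynomial.X ^ 2).coeff k + c * (p * Polynomial.X ^ 2).coeff (k + 1) -
      ((q * Polynomial.X ^ 2).coeff k + (c - #s) * (q * Polynomial.X ^ 2).coeff (k + 1)) := by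
    intro k
    rw [hPX]
    simp only [Polynomial.coeff_sub, Polynomial.coeff_add, Polynomial.coeff_X_mul,
      Polynomial.coeff_C_mul]
  have hdeg : P.degree < #s := by
    rw [Polynomial.degree_lt_iff_coeff_zero]
    intro k hk
    rw [← Polynomial.coeff_mul_X_pow P 2 k, show k + 2 = k + 1 + 1 by ring, hc]
    rcases hk.eq_or_lt with rfl | hk
    · rw [p1, q1, p2, q2, sum_add_distrib, sum_const, nsmul_one]; ring
    rcases (Nat.succ_le_of_lt hk).eq_or_lt with rfl | hk
    · rw [show (#s).succ + 1 = #s + 2 by rfl, p2, q2, pk _ (by omega), qk _ (by omega)]; ring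
    · rw [pk _ (by omega), pk _ (by omega), qk _ (by omega), qk _ (by omega)]; ring
  have h := Lagrange.coeff_eq_sum hu hdeg
  have hpos : 0 < #s := hne.card_pos
  rw [← Polynomial.coeff_mul_X_pow P 2, show #s - 1 + 2 = #s + 1 by omega, hc, p0, p1, q0, q1] at h
  have hev : ∀ i ∈ s, P.eval (u i) / ∏ j ∈ s.erase i, (u i - u j) =
      -((u i + c) * ∏ j ∈ s.erase i, ((u i - u j - 1) / (u i - u j))) := by
    intro i hi
    have h1 : p.eval (u i) = -∏ j ∈ s.erase i, (u i - u j - 1) := by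
      have := prod_sub_eq_erase hi u (-1)
      rw [hp, Polynomial.eval_prod]
      simp only [Polynomial.eval_sub, Polynomial.eval_X, Polynomial.eval_C, ← sub_sub,
        ← sub_eq_add_neg] at this ⊢
      rw [this]; ring
    have h2 : q.eval (u i) = 0 := by
      rw [hq, Polynomial.eval_prod]
      exact prod_eq_zero hi (by simp)
    rw [hP, Polynomial.eval_sub, Polynomial.eval_mul, Polynomial.eval_mul, h1, h2, prod_div_distrib]
    simp
    ring
  rw [sum_congr rfl hev, sum_neg_distrib] at h
  have e1 : ∑ j ∈ s, (u j + 1) = ∑ j ∈ s, u j + #s := by rw [sum_add_distrib]; simp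
  have e2 : ∑ j ∈ s, (u j + 1) ^ 2 = ∑ j ∈ s, u j ^ 2 + 2 * ∑ j ∈ s, u j + #s := by
    rw [mul_sum, ← sum_add_distrib]
    simp only [add_sq, sum_add_distrib]; simp
  rw [e1, e2] at h
  linarith

/-- The leg of the box of row `i` and arm `t` in the diagram with row lengths `f`,
when only the first `M` rows are present. -/
def legOfArm (f : ℕ → ℕ) (M i t : ℕ) : ℕ := #{k ∈ range M | i < k ∧ f i ≤ f k + t}

/-- The product over the boxes of the first `M` rows of `α * arm + leg + s`. -/
noncomputable def hookProd (α s : ℝ) (M : ℕ) (f : ℕ → ℕ) : ℝ :=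
  ∏ i ∈ range M, ∏ t ∈ range (f i), (α * t + legOfArm f M i t + s)

/-- The interaction factor of two rows at distance `e` whose lengths differ by `m`. -/
noncomputable def pairFactor (α s e : ℝ) (m : ℕ) : ℝ :=
  ∏ t ∈ range m, ((α * t + e - 1 + s) / (α * t + e + s))

lemma legOfArm_succ (f : ℕ → ℕ) (M i t : ℕ) :
    legOfArm f (M + 1) i t = legOfArm f M i t + if i < M ∧ f i ≤ f M + t then 1 else 0 := by
  unfold legOfArm
  rw [range_add_one, filter_insert]
  split_ifs with h
  · rw [card_insert_of_notMem (by simp)]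
  · simp

lemma arm_add_leg_eq {α s : ℝ} (hα : 0 < α) (hs : 0 < s) {f : ℕ → ℕ} (hf : Antitone f)
    {M i : ℕ} (hi : i < M) (t : ℕ) :
    α * t + legOfArm f M i t + s = (α * t + (M - 1 - i : ℝ) + s) *
      ∏ k ∈ range M, if i < k ∧ t < f i - f k then
        (α * t + (k - i : ℝ) - 1 + s) / (α * t + (k - i : ℝ) + s) else 1 := by
  induction M, (Nat.succ_le_of_lt hi) using Nat.le_induction with
  | base =>
    have h0 : legOfArm f i.succ i t = 0 := by
      simp only [legOfArm, card_eq_zero, filter_eq_empty_iff, mem_range]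
      intro k hk; omega
    rw [h0, prod_eq_one]
    · push_cast; ring
    · intro k hk
      rw [if_neg]
      have := mem_range.1 hk
      omega
  | succ M hM ih =>
    have hiM : i < M := hM
    have ih := ih hiM
    rw [legOfArm_succ, prod_range_succ]
    by_cases h : f i ≤ f M + t
    · rw [if_pos ⟨hiM, h⟩, if_neg (by omega)]
      have h1 : ∏ k ∈ range M, (if i < k ∧ t < f i - f k then
        (α * t + (k - i : ℝ) - 1 + s) / (α * t + (k - i : ℝ) + s) else 1) = 1 := by
        refine prod_eq_one fun k hk => if_neg ?_
        have := hf (mem_range.1 hk).le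
        omega
      rw [h1] at ih ⊢
      push_cast
      linarith
    · rw [if_neg (fun h' => h h'.2), if_pos ⟨hiM, by omega⟩]
      have hiM' : (i : ℝ) + 1 ≤ M := by exact_mod_cast hiM
      have hne : α * t + ((M : ℝ) - i) + s ≠ 0 := by
        have : 0 ≤ α * t := by positivity
        linarith
      rw [add_zero, ih]
      push_cast
      field_simp
      ring

lemma hookRow_eq {α s : ℝ} (hα : 0 < α) (hs : 0 < s) {f : ℕ → ℕ} (hf : Antitone f)
    {M i : ℕ} (hi : i < M) :
    ∏ t ∈ range (f i), (α * t + legOfArm f M i t + s) =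
      (∏ t ∈ range (f i), (α * t + (M - 1 - i : ℝ) + s)) *
      ∏ k ∈ range M, if i < k then pairFactor α s (k - i) (f i - f k) else 1 := by
  rw [prod_congr rfl fun t _ => arm_add_leg_eq hα hs hf hi t, prod_mul_distrib, prod_comm]
  congr 1
  refine prod_congr rfl fun k _ => ?_
  split_ifs with h
  · simp only [h, true_and]
    rw [← prod_filter, pairFactor]
    refine prod_congr ?_ fun _ _ => rfl
    ext t
    simp only [mem_filter, mem_range]
    omega
  · simp [h]

lemma pairFactor_succ (α s e : ℝ) (m : ℕ) :
    pairFactor α s e (m + 1) =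
      pairFactor α s e m * ((α * m + e - 1 + s) / (α * m + e + s)) := by
  rw [pairFactor, prod_range_succ, pairFactor]

/-- The content of the box following the last box of row `i`. -/
noncomputable def content (α : ℝ) (f : ℕ → ℕ) (i : ℕ) : ℝ := α * f i - i

/-- The factor by which the hook products change through the interaction of rows `i` and `k`
when a box is added to row `i`. -/
noncomputable def addRatio (α s : ℝ) (f : ℕ → ℕ) (i k : ℕ) : ℝ :=
  if i < k then (content α f i - content α f k - 1 + s) / (content α f i - content α f k + s)
  else (content α f k - content α f i - α + s) / (content α f k - content α f i - α - 1 + s)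

lemma hookProd_update {α s : ℝ} (hα : 0 < α) (hs : 0 < s) {f : ℕ → ℕ} (hf : Antitone f)
    {M i : ℕ} (hi : i < M) (hf' : Antitone (Function.update f i (f i + 1))) :
    hookProd α s M (Function.update f i (f i + 1)) = hookProd α s M f *
      ((content α f i + M - 1 + s) * ∏ k ∈ (range M).erase i, addRatio α s f i k) := by
  set g := Function.update f i (f i + 1) with hg
  have hgi : g i = f i + 1 := by simp [hg]
  have hgk : ∀ k, k ≠ i → g k = f k := fun k hk => by simp [hg, hk]
  unfold hookProd
  have hrow : ∀ r ∈ (range M).erase i,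
      ∏ t ∈ range (g r), (α * t + legOfArm g M r t + s) =
      (∏ t ∈ range (f r), (α * t + legOfArm f M r t + s)) *
        if i < r then 1 else addRatio α s f i r := by
    intro r hr
    obtain ⟨hri, hrM⟩ := mem_erase.1 hr
    rw [mem_range] at hrM
    rw [hookRow_eq hα hs hf' hrM, hookRow_eq hα hs hf hrM, hgk r hri, mul_assoc]
    congr 1
    split_ifs with h
    · rw [mul_one]
      refine prod_congr rfl fun k _ => ?_
      split_ifs with hk
      · rw [hgk k (by omega)]
      · rfl
    · have hlt : r < i := by omega
      have hle : f i + 1 ≤ f r := by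
        have := hf' hlt.le
        rwa [hgi, hgk r hri] at this
      rw [← mul_prod_erase _ _ (mem_range.2 hi), ← mul_prod_erase _ _ (mem_range.2 hi),
        if_pos hlt, if_pos hlt, hgi, show f r - f i = f r - (f i + 1) + 1 by omega,
        pairFactor_succ]
      have hP : ∏ k ∈ (range M).erase i,
          (if r < k then pairFactor α s (k - r) (f r - g k) else 1) =
          ∏ k ∈ (range M).erase i,
          (if r < k then pairFactor α s (k - r) (f r - f k) else 1) := by
        refine prod_congr rfl fun k hk => ?_
        rw [hgk k (mem_erase.1 hk).1]
      rw [hP]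
      have hm : ((f r - (f i + 1) : ℕ) : ℝ) = f r - f i - 1 := by
        rw [Nat.cast_sub hle]; push_cast; ring
      have hpos : 0 ≤ α * ((f r - (f i + 1) : ℕ) : ℝ) := by positivity
      have hri' : (r : ℝ) + 1 ≤ i := by exact_mod_cast hlt
      have hinv : (α * ((f r - (f i + 1) : ℕ) : ℝ) + (i - r) - 1 + s) /
          (α * ((f r - (f i + 1) : ℕ) : ℝ) + (i - r) + s) * addRatio α s f i r = 1 := by
        rw [addRatio, if_neg h]
        have e1 : content α f r - content α f i - α + s =
            α * ((f r - (f i + 1) : ℕ) : ℝ) + (i - r) + s := by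
          rw [hm]; unfold content; ring
        have e2 : content α f r - content α f i - α - 1 + s =
            α * ((f r - (f i + 1) : ℕ) : ℝ) + (i - r) - 1 + s := by
          rw [hm]; unfold content; ring
        rw [e1, e2]
        have n1 : α * ((f r - (f i + 1) : ℕ) : ℝ) + (i - r) + s ≠ 0 := by linarith
        have n2 : α * ((f r - (f i + 1) : ℕ) : ℝ) + (i - r) - 1 + s ≠ 0 := by linarith
        rw [div_mul_div_comm, mul_comm, div_self (mul_ne_zero n1 n2)]
      linear_combination (-(pairFactor α s (i - r) (f r - (f i + 1))) *
        ∏ k ∈ (range M).erase i,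
          (if r < k then pairFactor α s (k - r) (f r - f k) else 1)) * hinv
  have hrowi : ∏ t ∈ range (g i), (α * t + legOfArm g M i t + s) =
      (∏ t ∈ range (f i), (α * t + legOfArm f M i t + s)) *
      ((content α f i + M - 1 + s) *
        ∏ k ∈ (range M).erase i, if i < k then addRatio α s f i k else 1) := by
    rw [hookRow_eq hα hs hf' hi, hookRow_eq hα hs hf hi, hgi, prod_range_succ,
      ← mul_prod_erase _ _ (mem_range.2 hi), ← mul_prod_erase _ _ (mem_range.2 hi)]
    simp only [lt_irrefl, if_false, one_mul]
    have hP : ∏ k ∈ (range M).erase i,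
        (if i < k then pairFactor α s (k - i) (f i + 1 - g k) else 1) =
        (∏ k ∈ (range M).erase i,
          (if i < k then pairFactor α s (k - i) (f i - f k) else 1)) *
        ∏ k ∈ (range M).erase i, if i < k then addRatio α s f i k else 1 := by
      rw [← prod_mul_distrib]
      refine prod_congr rfl fun k hk => ?_
      split_ifs with h
      · have hle := hf h.le
        rw [hgk k (mem_erase.1 hk).1, show f i + 1 - f k = f i - f k + 1 by omega,
          pairFactor_succ, addRatio, if_pos h, Nat.cast_sub hle]
        unfold content
        congr 2 <;> ring
      · simp
    rw [hP]
    unfold content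
    ring
  rw [← mul_prod_erase _ _ (mem_range.2 hi), ← mul_prod_erase _ _ (mem_range.2 hi), hrowi,
    prod_congr rfl hrow, prod_mul_distrib]
  have hsplit : ∏ k ∈ (range M).erase i, addRatio α s f i k =
      (∏ k ∈ (range M).erase i, if i < k then addRatio α s f i k else 1) *
      ∏ k ∈ (range M).erase i, if i < k then 1 else addRatio α s f i k := by
    rw [← prod_mul_distrib]
    refine prod_congr rfl fun k _ => ?_
    split_ifs <;> simp
  rw [hsplit]
  ring

open Classical in
/-- The Young diagrams with `n` boxes and at most `M` rows, as functions giving row lengths. -/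
noncomputable def diagrams (M n : ℕ) : Finset (ℕ → ℕ) :=
  {f ∈ piAntidiag (range M) n | Antitone f}

lemma mem_diagrams {M n : ℕ} {f : ℕ → ℕ} :
    f ∈ diagrams M n ↔ (∑ i ∈ range M, f i = n ∧ ∀ i, f i ≠ 0 → i < M) ∧ Antitone f := by
  simp [diagrams]

lemma content_strict {α : ℝ} (hα : 0 < α) {f : ℕ → ℕ} (hf : Antitone f) {i k : ℕ} (h : i < k) :
    content α f k + 1 ≤ content α f i := by
  have h1 : (f k : ℝ) ≤ f i := by exact_mod_cast hf h.le
  have h2 : (i : ℝ) + 1 ≤ k := by exact_mod_cast h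
  have := mul_le_mul_of_nonneg_left h1 hα.le
  unfold content
  linarith

lemma content_injective {α : ℝ} (hα : 0 < α) {f : ℕ → ℕ} (hf : Antitone f) :
    Function.Injective (content α f) := by
  intro i k h
  by_contra hne
  rcases lt_or_gt_of_ne hne with h' | h' <;> linarith [content_strict hα hf h']

lemma content_add_pos {α : ℝ} (hα : 0 < α) (f : ℕ → ℕ) {M i : ℕ} (hi : i < M) :
    0 < content α f i + M := by
  have h2 : (i : ℝ) + 1 ≤ M := by exact_mod_cast hi
  have : 0 ≤ α * f i := by positivity
  unfold content
  linarith

/-- The probability that the growth process adds a box to row `i`. -/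
noncomputable def upProb (α : ℝ) (M : ℕ) (f : ℕ → ℕ) (i : ℕ) : ℝ :=
  (∏ k ∈ (range M).erase i,
    ((content α f i - content α f k + 1) / (content α f i - content α f k))) /
    (content α f i + M)

/-- The weight, proportional to a probability, of removing a box from row `i`. -/
noncomputable def downWeight (α : ℝ) (M : ℕ) (f : ℕ → ℕ) (i : ℕ) : ℝ :=
  (content α f i + (M - 1)) * ∏ k ∈ (range M).erase i,
    ((content α f i - content α f k - 1) / (content α f i - content α f k))

lemma prod_content_nonneg {α : ℝ} (hα : 0 < α) {f : ℕ → ℕ} (hf : Antitone f) (s : Finset ℕ)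
    (i : ℕ) (hi : i ∉ s) : 0 ≤ ∏ k ∈ s,
      ((content α f i - content α f k + 1) / (content α f i - content α f k)) := by
  refine prod_nonneg fun k hk => ?_
  rcases lt_trichotomy i k with h | rfl | h
  · have := content_strict hα hf h
    exact div_nonneg (by linarith) (by linarith)
  · exact absurd hk hi
  · have := content_strict hα hf h
    exact div_nonneg_of_nonpos (by linarith) (by linarith)

lemma upProb_nonneg {α : ℝ} (hα : 0 < α) {f : ℕ → ℕ} (hf : Antitone f) {M i : ℕ} (hi : i < M) :
    0 ≤ upProb α M f i :=
  div_nonneg (prod_content_nonneg hα hf _ i (notMem_erase _ _)) (content_add_pos hα f hi).le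

lemma sum_upProb_le_one {α : ℝ} (hα : 0 < α) {f : ℕ → ℕ} (hf : Antitone f) {M : ℕ}
    (hM : f M = 0) : ∑ i ∈ range M, upProb α M f i ≤ 1 := by
  have h := sum_transition_eq_one (range (M + 1)) (range M) (content α f)
    (content_injective hα hf).injOn (by simp) 1
  rw [sum_range_succ, range_add_one, erase_insert (by simp), ← prod_div_distrib] at h
  have hlast := prod_content_nonneg hα hf (range M) M (by simp)
  have hi : ∀ i ∈ range M, upProb α M f i =
      (∏ j ∈ range M, (content α f i - content α f j + 1)) /
        ∏ j ∈ (insert M (range M)).erase i, (content α f i - content α f j) := by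
    intro i hi
    have hne : i ≠ M := (mem_range.1 hi).ne
    have hcM : content α f M = -M := by simp [content, hM]
    rw [prod_sub_eq_erase hi, erase_insert_of_ne hne.symm, prod_insert (by simp), hcM, upProb,
      prod_div_distrib, one_mul, sub_neg_eq_add, div_div, mul_comm]
  rw [sum_congr rfl hi]
  linarith

lemma sum_downWeight {α : ℝ} (hα : 0 < α) {f : ℕ → ℕ} (hf : Antitone f) (M : ℕ) :
    ∑ i ∈ range M, downWeight α M f i = α * ∑ i ∈ range M, (f i : ℝ) := by
  have h := sum_cotransition (range M) (content α f) (content_injective hα hf).injOn (M - 1)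
  have hid : ∑ i ∈ range M, (i : ℝ) = M * (M - 1) / 2 := by
    induction M with
    | zero => simp
    | succ M ih =>
      rw [sum_range_succ, ih (sum_cotransition _ _ (content_injective hα hf).injOn _)]
      push_cast; ring
  simp only [downWeight]
  rw [h, card_range]
  simp only [content, sum_sub_distrib, hid, ← mul_sum]
  ring

lemma downWeight_eq_zero {α : ℝ} {f : ℕ → ℕ} {M i : ℕ} (hM : f M = 0) (hi : i < M)
    (h : f i = f (i + 1)) : downWeight α M f i = 0 := by
  unfold downWeight
  rcases (Nat.succ_le_of_lt hi).eq_or_lt with rfl | hlt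
  · rw [mul_eq_zero]; left
    simp [content, h, hM]
  · rw [mul_eq_zero]; right
    refine prod_eq_zero (i := i + 1) (by simp [hlt]) ?_
    simp [content, h]

lemma hookProd_pos {α s : ℝ} (hα : 0 < α) (hs : 0 < s) (M : ℕ) (f : ℕ → ℕ) :
    0 < hookProd α s M f :=
  prod_pos fun i _ => prod_pos fun t _ => by positivity

lemma addRatio_mul (α : ℝ) (f : ℕ → ℕ) (i k : ℕ) :
    addRatio α 1 f i k * addRatio α α f i k =
      (content α f i - content α f k) / (content α f i - content α f k + 1) *
      ((content α f i - content α f k + α - 1) / (content α f i - content α f k + α)) := by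
  unfold addRatio
  split_ifs
  · rw [sub_add_cancel]; ring
  · rw [← neg_div_neg_eq (content α f k - content α f i - α + 1),
      ← neg_div_neg_eq (content α f k - content α f i - α + α)]
    rw [mul_comm]
    congr 2 <;> ring

lemma downWeight_div_hookProd {α : ℝ} (hα : 0 < α) {f : ℕ → ℕ} (hf : Antitone f)
    {M i : ℕ} (hi : i < M) (hf' : Antitone (Function.update f i (f i + 1))) :
    downWeight α M (Function.update f i (f i + 1)) i *
      (hookProd α 1 M (Function.update f i (f i + 1)) *
        hookProd α α M (Function.update f i (f i + 1)))⁻¹ =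
    upProb α M f i * (hookProd α 1 M f * hookProd α α M f)⁻¹ := by
  have H1 := hookProd_pos hα one_pos M f
  have H2 := hookProd_pos hα hα M f
  have H3 := hookProd_pos hα one_pos M (Function.update f i (f i + 1))
  have H4 := hookProd_pos hα hα M (Function.update f i (f i + 1))
  rw [← div_eq_mul_inv, ← div_eq_mul_inv, div_eq_div_iff (by positivity) (by positivity)]
  rw [hookProd_update hα one_pos hf hi hf', hookProd_update hα hα hf hi hf']
  set g := Function.update f i (f i + 1) with hg
  have hgi : content α g i = content α f i + α := by simp [hg, content]; ring
  have hgk : ∀ k ∈ (range M).erase i, content α g k = content α f k := fun k hk => by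
    simp [hg, content, (mem_erase.1 hk).1]
  have hx := content_add_pos hα f hi
  have hdown : downWeight α M g i = (content α f i + α + (M - 1)) * ∏ k ∈ (range M).erase i,
      ((content α f i - content α f k + α - 1) / (content α f i - content α f k + α)) := by
    rw [downWeight, hgi]
    congr 1
    refine prod_congr rfl fun k hk => ?_
    rw [hgk k hk]
    congr 1 <;> ring
  have hprod : (∏ k ∈ (range M).erase i,
      ((content α f i - content α f k + 1) / (content α f i - content α f k))) *
      ((∏ k ∈ (range M).erase i, addRatio α 1 f i k) *
        ∏ k ∈ (range M).erase i, addRatio α α f i k) =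
      ∏ k ∈ (range M).erase i,
      ((content α f i - content α f k + α - 1) / (content α f i - content α f k + α)) := by
    rw [← prod_mul_distrib, ← prod_mul_distrib]
    refine prod_congr rfl fun k hk => ?_
    rw [addRatio_mul, ← mul_assoc]
    have hd : content α f i - content α f k ≠ 0 ∧ content α f i - content α f k + 1 ≠ 0 := by
      rcases lt_or_gt_of_ne (mem_erase.1 hk).1 with h | h
      · have := content_strict hα hf' h
        rw [hgi, hgk k hk] at this
        constructor <;> linarith
      · have := content_strict hα hf h
        constructor <;> linarith
    rw [div_mul_div_comm, mul_comm (content α f i - content α f k + 1),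
      div_self (mul_ne_zero hd.1 hd.2), one_mul]
  rw [hdown, ← hprod, upProb]
  field_simp
  ring

/-- The sum of the reciprocal hook products over all diagrams with `n` boxes. -/
noncomputable def hookSum (α : ℝ) (M n : ℕ) : ℝ :=
  ∑ f ∈ diagrams M n, (hookProd α 1 M f * hookProd α α M f)⁻¹

lemma update_pred_antitone {f : ℕ → ℕ} (hf : Antitone f) {i : ℕ} (h : f (i + 1) < f i) :
    Antitone (Function.update f i (f i - 1)) := by
  intro a b hab
  by_cases ha : a = i <;> by_cases hb : b = i
  · simp [ha, hb]
  · subst ha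
    have := hf (show a + 1 ≤ b by omega)
    simp [hb]; omega
  · subst hb
    have := hf hab
    simp [ha]; omega
  · simp [ha, hb, hf hab]

lemma update_pred_mem_diagrams {M n : ℕ} {f : ℕ → ℕ} (hf : f ∈ diagrams M (n + 1)) {i : ℕ}
    (hi : i < M) (h : f (i + 1) < f i) :
    Function.update f i (f i - 1) ∈ diagrams M n := by
  obtain ⟨⟨hsum, hsupp⟩, hanti⟩ := mem_diagrams.1 hf
  refine mem_diagrams.2 ⟨⟨?_, fun k hk => ?_⟩, update_pred_antitone hanti h⟩
  · rw [sum_update_of_mem (mem_range.2 hi)]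
    rw [← add_sum_erase _ _ (mem_range.2 hi), ← sdiff_singleton_eq_erase] at hsum
    omega
  · by_cases hki : k = i
    · rwa [hki]
    · exact hsupp k (by simpa [hki] using hk)

lemma hookSum_succ_le {α : ℝ} (hα : 0 < α) (M n : ℕ) :
    α * (n + 1) * hookSum α M (n + 1) ≤ hookSum α M n := by
  set w : (ℕ → ℕ) → ℝ := fun f => (hookProd α 1 M f * hookProd α α M f)⁻¹ with hw
  have hw0 : ∀ f, 0 ≤ w f := fun f =>
    inv_nonneg.2 (mul_pos (hookProd_pos hα one_pos M f) (hookProd_pos hα hα M f)).le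
  have hzero : ∀ m, ∀ f ∈ diagrams M m, f M = 0 := fun m f hf => by
    by_contra h
    exact lt_irrefl _ ((mem_diagrams.1 hf).1.2 M h)
  calc α * (n + 1) * hookSum α M (n + 1)
      = ∑ g ∈ diagrams M (n + 1), ∑ i ∈ range M, downWeight α M g i * w g := by
        rw [hookSum, mul_sum]
        refine sum_congr rfl fun g hg => ?_
        obtain ⟨⟨hsum, -⟩, hanti⟩ := mem_diagrams.1 hg
        rw [← sum_mul, sum_downWeight hα hanti, ← Nat.cast_sum, hsum]
        push_cast; rfl
    _ = ∑ p ∈ (diagrams M (n + 1) ×ˢ range M).filter (fun p => p.1 (p.2 + 1) < p.1 p.2),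
          downWeight α M p.1 p.2 * w p.1 := by
        rw [← sum_product', sum_filter_of_ne]
        rintro ⟨g, i⟩ hp hne
        obtain ⟨hg, hi⟩ := mem_product.1 hp
        refine lt_of_le_of_ne ((mem_diagrams.1 hg).2 (Nat.le_succ i)) fun h => hne ?_
        simp only
        rw [downWeight_eq_zero (hzero _ g hg) (mem_range.1 hi) h.symm, zero_mul]
    _ ≤ ∑ p ∈ diagrams M n ×ˢ range M, upProb α M p.1 p.2 * w p.1 := by
        classical
        set φ : (ℕ → ℕ) × ℕ → (ℕ → ℕ) × ℕ :=
          fun p => (Function.update p.1 p.2 (p.1 p.2 - 1), p.2) with hφ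
        have hback : ∀ p : (ℕ → ℕ) × ℕ, p.1 (p.2 + 1) < p.1 p.2 →
            Function.update (φ p).1 p.2 ((φ p).1 p.2 + 1) = p.1 := by
          intro p hp
          simp only [hφ, Function.update_self, Function.update_idem]
          rw [Nat.sub_add_cancel (by omega), Function.update_eq_self]
        have hinj : Set.InjOn φ
            ((diagrams M (n + 1) ×ˢ range M).filter (fun p => p.1 (p.2 + 1) < p.1 p.2)) := by
          intro p hp q hq hpq
          have h2 : p.2 = q.2 := (Prod.ext_iff.1 hpq).2
          have hp' := hback p (mem_filter.1 (mem_coe.1 hp)).2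
          have hq' := hback q (mem_filter.1 (mem_coe.1 hq)).2
          rw [hpq, h2, hq'] at hp'
          exact Prod.ext hp'.symm h2
        have hterm : ∀ p ∈ (diagrams M (n + 1) ×ˢ range M).filter
            (fun p => p.1 (p.2 + 1) < p.1 p.2), downWeight α M p.1 p.2 * w p.1 =
              upProb α M (φ p).1 (φ p).2 * w (φ p).1 := by
          intro p hp
          obtain ⟨hp, hlt⟩ := mem_filter.1 hp
          obtain ⟨hg, hi⟩ := mem_product.1 hp
          have hanti := (mem_diagrams.1 hg).2
          have h := downWeight_div_hookProd hα (update_pred_antitone hanti hlt)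
            (mem_range.1 hi)
          have hb := hback p hlt
          simp only [hφ] at hb
          rw [hb] at h
          exact h hanti
        rw [sum_congr rfl hterm,
          ← sum_image (f := fun p => upProb α M p.1 p.2 * w p.1) hinj]
        refine sum_le_sum_of_subset_of_nonneg ?_ ?_
        · intro q hq
          obtain ⟨p, hp, rfl⟩ := mem_image.1 hq
          obtain ⟨hp, hlt⟩ := mem_filter.1 hp
          obtain ⟨hg, hi⟩ := mem_product.1 hp
          exact mem_product.2 ⟨update_pred_mem_diagrams hg (mem_range.1 hi) hlt, hi⟩
        · intro p hp _
          obtain ⟨hf, hi⟩ := mem_product.1 hp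
          exact mul_nonneg (upProb_nonneg hα (mem_diagrams.1 hf).2 (mem_range.1 hi)) (hw0 _)
    _ = ∑ f ∈ diagrams M n, (∑ i ∈ range M, upProb α M f i) * w f := by
        rw [sum_product]
        simp only [sum_mul]
    _ ≤ hookSum α M n := by
        refine sum_le_sum fun f hf => ?_
        exact mul_le_of_le_one_left (hw0 f)
          (sum_upProb_le_one hα (mem_diagrams.1 hf).2 (hzero _ f hf))

lemma hookSum_le {α : ℝ} (hα : 0 < α) (M n : ℕ) :
    hookSum α M n ≤ (α ^ n * n.factorial)⁻¹ := by
  induction n with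
  | zero =>
    have : diagrams M 0 ⊆ {0} := by
      intro f hf
      obtain ⟨⟨hsum, hsupp⟩, -⟩ := mem_diagrams.1 hf
      rw [mem_singleton]
      ext i
      by_contra h
      exact h (sum_eq_zero_iff.1 hsum i (mem_range.2 (hsupp i h)))
    refine (sum_le_sum_of_subset_of_nonneg this fun f _ _ => ?_).trans ?_
    · exact inv_nonneg.2 (mul_pos (hookProd_pos hα one_pos M f) (hookProd_pos hα hα M f)).le
    · simp [hookProd]
  | succ n ih =>
    have h := (hookSum_succ_le hα M n).trans ih
    have hn : 0 < α * ((n : ℝ) + 1) := by positivity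
    rw [← le_div_iff₀' hn] at h
    refine h.trans_eq ?_
    rw [Nat.factorial_succ]
    push_cast
    field_simp
    ring

lemma lt_card_filter_range_iff {n : ℕ} {P : ℕ → Prop} [DecidablePred P]
    (hP : ∀ a b, a ≤ b → P b → P a) (j : ℕ) : j < #{k ∈ range n | P k} ↔ j < n ∧ P j := by
  constructor
  · intro h
    by_contra hj
    have hsub : {k ∈ range n | P k} ⊆ range j := by
      intro k hk
      obtain ⟨hkn, hk⟩ := mem_filter.1 hk
      rw [mem_range] at hkn ⊢
      by_contra hjk
      exact hj ⟨by omega, hP j k (by omega) hk⟩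
    have := card_le_card hsub
    rw [card_range] at this
    omega
  · rintro ⟨hj, hPj⟩
    have hsub : range (j + 1) ⊆ {k ∈ range n | P k} := by
      intro k hk
      have hk := mem_range.1 hk
      exact mem_filter.2 ⟨mem_range.2 (by omega), hP k j (by omega) hPj⟩
    have := card_le_card hsub
    rwa [card_range] at this

lemma colLen_antitone {n : ℕ} (lam : n.Partition) : Antitone (colLen lam) := by
  intro a b hab
  exact Multiset.card_le_card (Multiset.monotone_filter_right _ fun p hp => by omega)

lemma rowLen_antitone {n : ℕ} (lam : n.Partition) : Antitone (rowLen lam) := by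
  intro a b hab
  refine card_le_card fun j hj => ?_
  simp only [mem_filter] at hj ⊢
  exact ⟨hj.1, by omega⟩

lemma rowLen_le {n : ℕ} (lam : n.Partition) (i : ℕ) : rowLen lam i ≤ n :=
  (card_filter_le _ _).trans (card_range n).le

lemma le_of_mem_parts {n : ℕ} (lam : n.Partition) {p : ℕ} (hp : p ∈ lam.parts) : p ≤ n := by
  have := Multiset.le_sum_of_mem hp
  rwa [lam.parts_sum] at this

lemma colLen_le {n : ℕ} (lam : n.Partition) (j : ℕ) : colLen lam j ≤ n := by
  refine (Multiset.card_le_card (Multiset.filter_le _ _)).trans ?_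
  have h := Multiset.card_nsmul_le_sum (s := lam.parts) (a := 1) fun p hp => lam.parts_pos hp
  rwa [lam.parts_sum, smul_eq_mul, mul_one] at h

lemma colLen_of_le {n : ℕ} (lam : n.Partition) {j : ℕ} (hj : n ≤ j) : colLen lam j = 0 := by
  rw [colLen, Multiset.card_eq_zero, Multiset.filter_eq_nil]
  intro p hp
  have := le_of_mem_parts lam hp
  omega

lemma lt_rowLen_iff {n : ℕ} (lam : n.Partition) (i j : ℕ) :
    j < rowLen lam i ↔ i < colLen lam j := by
  rw [rowLen, lt_card_filter_range_iff fun a b hab h => h.trans_le (colLen_antitone lam hab)]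
  refine ⟨fun h => h.2, fun h => ⟨?_, h⟩⟩
  by_contra hj
  rw [colLen_of_le lam (by omega)] at h
  omega

lemma colLen_eq_card {n : ℕ} (lam : n.Partition) (j : ℕ) :
    colLen lam j = #{k ∈ range n | j < rowLen lam k} := by
  simp only [lt_rowLen_iff]
  have : {k ∈ range n | k < colLen lam j} = range (colLen lam j) := by
    ext k
    have := colLen_le lam j
    simp only [mem_filter, mem_range]
    omega
  rw [this, card_range]

lemma sum_rowLen {n : ℕ} (lam : n.Partition) : ∑ i ∈ range n, rowLen lam i = n := by
  simp only [rowLen, card_filter]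
  rw [sum_comm]
  have h1 : ∀ j, ∑ i ∈ range n, (if i < colLen lam j then 1 else 0) = colLen lam j := by
    intro j
    simp only [← lt_rowLen_iff]
    rw [← card_filter, ← colLen_eq_card]
  simp only [h1]
  have h2 : ∀ m : Multiset ℕ, (∀ p ∈ m, p ≤ n) →
      ∑ j ∈ range n, (m.filter (fun p => j < p)).card = m.sum := by
    intro m
    induction m using Multiset.induction_on with
    | empty => simp
    | cons a m ih =>
      intro h
      have ha := h a (Multiset.mem_cons_self a m)
      have hr : {j ∈ range n | j < a} = range a := by
        ext j
        simp only [mem_filter, mem_range]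
        omega
      simp only [← Multiset.countP_eq_card_filter, Multiset.countP_cons, sum_add_distrib,
        Multiset.sum_cons] at ih ⊢
      rw [ih fun p hp => h p (Multiset.mem_cons_of_mem hp), ← card_filter, hr, card_range,
        add_comm]
  exact (h2 lam.parts fun p hp => le_of_mem_parts lam hp).trans lam.parts_sum

lemma rowLen_injective {n : ℕ} : Function.Injective (rowLen (n := n)) := by
  intro lam mu h
  have hc : ∀ j, colLen lam j = colLen mu j := fun j => by
    rw [colLen_eq_card, colLen_eq_card, h]
  have hcount : ∀ (nu : n.Partition) (p : ℕ),
      nu.parts.count (p + 1) = colLen nu p - colLen nu (p + 1) := by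
    intro nu p
    have : ∀ m : Multiset ℕ, m.countP (fun q => p < q) =
        m.count (p + 1) + m.countP (fun q => p + 1 < q) := by
      intro m
      induction m using Multiset.induction_on with
      | empty => simp
      | cons a m ih =>
        rw [Multiset.countP_cons, Multiset.countP_cons, Multiset.count_cons, ih]
        split_ifs <;> omega
    rw [colLen, colLen, ← Multiset.countP_eq_card_filter, ← Multiset.countP_eq_card_filter, this]
    omega
  refine Nat.Partition.ext (Multiset.ext.2 fun p => ?_)
  rcases p with _ | p
  · rw [Multiset.count_eq_zero_of_notMem fun h => (lam.parts_pos h).ne rfl,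
      Multiset.count_eq_zero_of_notMem fun h => (mu.parts_pos h).ne rfl]
  · rw [hcount, hcount, hc, hc]

lemma rowLen_mem_diagrams {n : ℕ} (lam : n.Partition) : rowLen lam ∈ diagrams n n := by
  refine mem_diagrams.2 ⟨⟨sum_rowLen lam, fun i hi => ?_⟩, rowLen_antitone lam⟩
  exact ((lt_rowLen_iff lam i 0).1 (by omega)).trans_le (colLen_le lam 0)

lemma leg_eq_legOfArm {n : ℕ} (lam : n.Partition) {i t : ℕ} (hi : i < n) (ht : t < rowLen lam i) :
    leg lam (i, rowLen lam i - 1 - t) = legOfArm (rowLen lam) n i t := by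
  have hanti := rowLen_antitone lam
  have hunion : {k ∈ range n | rowLen lam i - 1 - t < rowLen lam k} =
      range (i + 1) ∪ {k ∈ range n | i < k ∧ rowLen lam i ≤ rowLen lam k + t} := by
    ext k
    simp only [mem_filter, mem_union, mem_range]
    by_cases hk : i < k
    · omega
    · have := hanti (show k ≤ i by omega)
      omega
  have hdisj : Disjoint (range (i + 1))
      {k ∈ range n | i < k ∧ rowLen lam i ≤ rowLen lam k + t} := by
    rw [disjoint_left]
    intro k hk hk'
    have := mem_range.1 hk
    have := (mem_filter.1 hk').2.1
    omega
  rw [leg, colLen_eq_card, hunion, card_union_of_disjoint hdisj, card_range, legOfArm]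
  simp

lemma prod_cells {n : ℕ} (lam : n.Partition) (α s : ℝ) :
    ∏ c ∈ cells lam, (α * arm lam c + leg lam c + s) = hookProd α s n (rowLen lam) := by
  rw [cells, prod_filter, prod_product, hookProd]
  refine prod_congr rfl fun i hi => ?_
  have hr : {j ∈ range n | j < rowLen lam i} = range (rowLen lam i) := by
    ext j
    have := rowLen_le lam i
    simp only [mem_filter, mem_range]
    omega
  simp only
  rw [← prod_filter, hr, ← prod_range_reflect]
  refine prod_congr rfl fun t ht => ?_
  rw [leg_eq_legOfArm lam (mem_range.1 hi) (mem_range.1 ht), arm]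
  have := mem_range.1 ht
  simp only
  rw [show rowLen lam i - (rowLen lam i - 1 - t + 1) = t by omega]

lemma jackP_eq {n : ℕ} (lam : n.Partition) (α : ℝ) :
    jackP α lam = α ^ n * n.factorial *
      (hookProd α 1 n (rowLen lam) * hookProd α α n (rowLen lam))⁻¹ := by
  rw [jackP, cLow, cUp, prod_cells, prod_cells, div_eq_mul_inv]

lemma legOfArm_tail (f : ℕ → ℕ) (M i t : ℕ) :
    legOfArm f (M + 1) (i + 1) t = legOfArm (fun k => f (k + 1)) M i t := by
  simp only [legOfArm, card_filter]
  rw [sum_range_succ']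
  simp

lemma hookProd_tail_le {α s : ℝ} (hα : 0 < α) (hs : 0 < s) (M : ℕ) (f : ℕ → ℕ) :
    (∏ t ∈ range (f 0), (α * t + s)) * hookProd α s M (fun k => f (k + 1)) ≤
      hookProd α s (M + 1) f := by
  rw [hookProd.eq_1 α s (M + 1), prod_range_succ', mul_comm]
  simp only [legOfArm_tail]
  refine mul_le_mul_of_nonneg_left ?_ (hookProd_pos hα hs M _).le
  refine prod_le_prod (fun t _ => by positivity) fun t _ => ?_
  have : (0 : ℝ) ≤ legOfArm f (M + 1) 0 t := Nat.cast_nonneg _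
  linarith

lemma tail_mem_diagrams {M n : ℕ} {f : ℕ → ℕ} (hf : f ∈ diagrams (M + 1) n) :
    (fun k => f (k + 1)) ∈ diagrams M (n - f 0) := by
  obtain ⟨⟨hsum, hsupp⟩, hanti⟩ := mem_diagrams.1 hf
  refine mem_diagrams.2 ⟨⟨?_, fun i hi => ?_⟩, fun a b hab => hanti (by omega)⟩
  · rw [sum_range_succ'] at hsum
    omega
  · have := hsupp (i + 1) hi
    omega

lemma sum_jackP_rowLen_eq_le {α : ℝ} (hα : 0 < α) {n l : ℕ} (hn : 1 ≤ n) (hl : l ≤ n) :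
    ∑ lam : n.Partition with rowLen lam 0 = l, jackP α lam ≤
      α ^ l * n.descFactorial l /
        ((∏ t ∈ range l, (α * t + 1)) * ∏ t ∈ range l, (α * t + α)) := by
  classical
  obtain ⟨M, rfl⟩ : ∃ M, n = M + 1 := ⟨n - 1, by omega⟩
  set A := (∏ t ∈ range l, (α * t + 1)) * ∏ t ∈ range l, (α * t + α) with hA
  have hA0 : 0 < A :=
    mul_pos (prod_pos fun t _ => by positivity) (prod_pos fun t _ => by positivity)
  set w : (ℕ → ℕ) → ℝ := fun f => (hookProd α 1 M f * hookProd α α M f)⁻¹ with hw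
  have hw0 : ∀ f, 0 ≤ w f := fun f =>
    inv_nonneg.2 (mul_pos (hookProd_pos hα one_pos M f) (hookProd_pos hα hα M f)).le
  set c : ℝ := α ^ (M + 1) * (M + 1).factorial * A⁻¹ with hc
  have hc0 : 0 ≤ c := by positivity
  let φ : (M + 1).Partition → ℕ → ℕ := fun lam k => rowLen lam (k + 1)
  have hinj : Set.InjOn φ (({lam : (M + 1).Partition | rowLen lam 0 = l} : Finset _) : Set _) := by
    intro lam h1 mu h2 h
    have h1 := (mem_filter.1 (mem_coe.1 h1)).2
    have h2 := (mem_filter.1 (mem_coe.1 h2)).2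
    refine rowLen_injective (funext fun k => ?_)
    rcases k with _ | k
    · rw [h1, h2]
    · exact congrFun h k
  calc ∑ lam : (M + 1).Partition with rowLen lam 0 = l, jackP α lam
      ≤ ∑ lam : (M + 1).Partition with rowLen lam 0 = l, c * w (φ lam) := by
        refine sum_le_sum fun lam hlam => ?_
        have hl := (mem_filter.1 hlam).2
        rw [jackP_eq, hc, mul_assoc (α ^ (M + 1) * _), hw, ← mul_inv]
        refine mul_le_mul_of_nonneg_left ?_ (by positivity)
        have p1 := hookProd_pos hα one_pos M (φ lam)
        have p2 := hookProd_pos hα hα M (φ lam)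
        refine inv_anti₀ (by positivity) ?_
        have t1 := hookProd_tail_le hα one_pos M (rowLen lam)
        have t2 := hookProd_tail_le hα hα M (rowLen lam)
        rw [hl] at t1 t2
        rw [hA, mul_mul_mul_comm]
        exact mul_le_mul t1 t2 (mul_nonneg (prod_nonneg fun t _ => by positivity) p2.le)
          (hookProd_pos hα one_pos _ _).le
    _ = c * ∑ f ∈ image φ {lam : (M + 1).Partition | rowLen lam 0 = l}, w f := by
        rw [sum_image hinj, mul_sum]
    _ ≤ c * hookSum α M (M + 1 - l) := by
        refine mul_le_mul_of_nonneg_left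
          (sum_le_sum_of_subset_of_nonneg ?_ fun f _ _ => hw0 f) hc0
        intro f hf
        obtain ⟨lam, hlam, rfl⟩ := mem_image.1 hf
        have h := tail_mem_diagrams (rowLen_mem_diagrams lam)
        rwa [(mem_filter.1 hlam).2] at h
    _ ≤ c * (α ^ (M + 1 - l) * (M + 1 - l).factorial)⁻¹ :=
        mul_le_mul_of_nonneg_left (hookSum_le hα _ _) hc0
    _ = _ := by
        have hfac : ((M + 1).factorial : ℝ) =
            (M + 1 - l).factorial * (M + 1).descFactorial l := by
          exact_mod_cast (Nat.factorial_mul_descFactorial hl).symm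
        have hpow : α ^ (M + 1) = α ^ (M + 1 - l) * α ^ l := by
          rw [← pow_add, Nat.sub_add_cancel hl]
        rw [hc, hfac, hpow]
        field_simp

lemma prod_mul_add_self (α : ℝ) (l : ℕ) :
    ∏ t ∈ range l, (α * t + α) = α ^ l * l.factorial := by
  induction l with
  | zero => simp
  | succ l ih => rw [prod_range_succ, ih, Nat.factorial_succ]; push_cast; ring

lemma pow_mul_factorial_le_prod {α : ℝ} (hα : 0 < α) (l : ℕ) :
    α ^ l * l.factorial ≤ ∏ t ∈ range (l + 1), (α * t + 1) := by
  rw [prod_range_succ', ← prod_mul_add_self]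
  simp only [Nat.cast_zero, mul_zero, zero_add, mul_one]
  refine prod_le_prod (fun t _ => by positivity) fun t _ => ?_
  push_cast
  linarith

lemma sum_jackP_rowLen_eq_le_div {α : ℝ} (hα : 0 < α) {n l : ℕ} (hn : 1 ≤ n) (hl : l ≤ n)
    (hl1 : 1 ≤ l) (hL : 2 * Real.exp 1 * √(n / α) ≤ l) :
    ∑ lam : n.Partition with rowLen lam 0 = l, jackP α lam ≤
      α * n / (4 : ℝ) ^ (2 * Real.exp 1 * √((n : ℝ) / α)) := by
  have hl0 : (0 : ℝ) < l := by exact_mod_cast hl1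
  have hfac : (0 : ℝ) < l.factorial := by exact_mod_cast l.factorial_pos
  have hratio : Real.exp 1 ^ 2 * (n / α) ≤ l ^ 2 / 4 := by
    have h := pow_le_pow_left₀ (by positivity) hL 2
    rw [mul_pow, mul_pow, Real.sq_sqrt (by positivity)] at h
    linarith
  have hstirling : (l : ℝ) ^ l ≤ Real.exp 1 ^ l * l.factorial := by
    have h := Real.pow_div_factorial_le_exp (l : ℝ) hl0.le l
    rwa [div_le_iff₀ hfac, ← Real.exp_one_pow] at h
  have hmain : ((n : ℝ) / α) ^ l / (l.factorial : ℝ) ^ 2 ≤ (1 / 4) ^ l := by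
    have h1 : (Real.exp 1 ^ 2 * (n / α)) ^ l ≤ (l ^ 2 / 4) ^ l :=
      pow_le_pow_left₀ (by positivity) hratio l
    have h2 : ((l : ℝ) ^ l) ^ 2 ≤ (Real.exp 1 ^ l * l.factorial) ^ 2 :=
      pow_le_pow_left₀ (by positivity) hstirling 2
    rw [div_le_iff₀ (by positivity)]
    have he : 0 < (Real.exp 1 ^ l) ^ 2 := by positivity
    refine le_of_mul_le_mul_left ?_ he
    calc (Real.exp 1 ^ l) ^ 2 * ((n : ℝ) / α) ^ l = (Real.exp 1 ^ 2 * ((n : ℝ) / α)) ^ l := by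
          rw [mul_pow]; ring
      _ ≤ ((l : ℝ) ^ 2 / 4) ^ l := h1
      _ = (1 / 4) ^ l * ((l : ℝ) ^ l) ^ 2 := by
          rw [div_eq_mul_one_div, mul_pow]; ring
      _ ≤ (1 / 4) ^ l * (Real.exp 1 ^ l * l.factorial) ^ 2 :=
          mul_le_mul_of_nonneg_left h2 (by positivity)
      _ = _ := by ring
  have hprod : α ^ l * l.factorial / (α * l) ≤ ∏ t ∈ range l, (α * t + 1) := by
    obtain ⟨k, rfl⟩ : ∃ k, l = k + 1 := ⟨l - 1, by omega⟩
    refine le_trans (le_of_eq ?_) (pow_mul_factorial_le_prod hα k)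
    rw [Nat.factorial_succ]
    push_cast
    field_simp
    ring
  calc ∑ lam : n.Partition with rowLen lam 0 = l, jackP α lam
      ≤ α ^ l * n.descFactorial l /
        ((∏ t ∈ range l, (α * t + 1)) * ∏ t ∈ range l, (α * t + α)) :=
        sum_jackP_rowLen_eq_le hα hn hl
    _ ≤ α ^ l * n ^ l / ((α ^ l * l.factorial / (α * l)) * (α ^ l * l.factorial)) := by
        rw [prod_mul_add_self]
        have hd : (n.descFactorial l : ℝ) ≤ n ^ l := by
          exact_mod_cast Nat.descFactorial_le_pow n l
        gcongr
    _ = α * l * (((n : ℝ) / α) ^ l / (l.factorial : ℝ) ^ 2) := by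
        rw [div_pow]
        field_simp
    _ ≤ α * n * (1 / 4) ^ l := by
        have : (l : ℝ) ≤ n := by exact_mod_cast hl
        gcongr
    _ = α * n / (4 : ℝ) ^ (l : ℝ) := by
        rw [Real.rpow_natCast, one_div, inv_pow, div_eq_mul_inv]
    _ ≤ _ := by
        gcongr
        norm_num

/-- Tail bound for the largest part `λ₁` under Jack measure. -/
theorem jack_tail_lambda1 (α : ℝ) (hα : 0 < α) (n : ℕ) (hn : 1 ≤ n) :
    (∑ lam : n.Partition,
        if 2 * Real.exp 1 * Real.sqrt ((n : ℝ) / α) ≤ (rowLen lam 0 : ℝ) then jackP α lam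
        else 0) ≤
      α * (n : ℝ) ^ 2 / (4 : ℝ) ^ (2 * Real.exp 1 * Real.sqrt ((n : ℝ) / α)) := by
  set L := 2 * Real.exp 1 * Real.sqrt ((n : ℝ) / α) with hL
  have hn0 : (0 : ℝ) < n := by exact_mod_cast hn
  have hL0 : 0 < L := by positivity
  rw [← sum_filter, ← sum_fiberwise_of_maps_to (t := Icc 1 n) (g := fun lam => rowLen lam 0)]
  · calc _ ≤ ∑ l ∈ Icc 1 n, α * n / (4 : ℝ) ^ L := by
          refine sum_le_sum fun l hl => ?_
          obtain ⟨hl1, hln⟩ := mem_Icc.1 hl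
          by_cases hLl : L ≤ l
          · rw [filter_filter]
            refine le_trans (le_of_eq (sum_congr ?_ fun _ _ => rfl))
              (sum_jackP_rowLen_eq_le_div hα hn hln hl1 hLl)
            ext lam
            simp only [mem_filter, mem_univ, true_and]
            exact ⟨fun h => h.2, fun h => ⟨by rwa [h], h⟩⟩
          · rw [sum_eq_zero]
            · positivity
            · intro lam hlam
              simp only [mem_filter, mem_univ, true_and] at hlam
              exact absurd (hlam.2 ▸ hlam.1) hLl
      _ = _ := by
          rw [sum_const, Nat.card_Icc, Nat.add_sub_cancel, nsmul_eq_mul]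
          ring
  · intro lam hlam
    have h := (mem_filter.1 hlam).2
    refine mem_Icc.2 ⟨?_, rowLen_le lam 0⟩
    have : (0 : ℝ) < rowLen lam 0 := hL0.trans_le h
    exact_mod_cast this

end JackTest
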